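/- Let C ⊆ ℝ^n be nonempty, convex and compact, let f : ℝ^n → ℝ be convex, let G : ℝ^n → ℝ^n be continuous and monotone, let ε > 0 and let B ⊆ C be nonempty. Define ψ^M_B(x) := sup{⟨G(y), x − y⟩ : y ∈ B}. Then there exists ρ_B > 0 such that for every ρ ≥ ρ_B, every minimizer x of the penalized function f(·) + ρ · max(ψ^M_B(·) − ε, 0) over C satisfies ψ^M_B(x) ≤ ε and is an optimal solution of min{f(x) : x ∈ C, ψ^M_B(x) ≤ ε}. -/

import Mathlib

open RealInnerProductSpace

/-- The approximated Minty gap function `ψ^M_B(x) = sup {⟪G y, x - y⟫ : y ∈ B}`. -/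
noncomputable def psiMB {n : ℕ} (G : EuclideanSpace ℝ (Fin n) → EuclideanSpace ℝ (Fin n))
    (B : Set (EuclideanSpace ℝ (Fin n))) (x : EuclideanSpace ℝ (Fin n)) : ℝ :=
  sSup ((fun y => ⟪G y, x - y⟫) '' B)

/-- Finite form of Minty's lemma: finitely many Minty inequalities of a monotone map have a common
solution. -/
theorem exists_forall_inner_sub_nonpos_of_finset {E : Type*} [NormedAddCommGroup E]
    [InnerProductSpace ℝ E] {C : Set E} (hne : C.Nonempty) (hconv : Convex ℝ C)
    (hcomp : IsCompact C) {G : E → E} (hGm : ∀ x y : E, 0 ≤ ⟪G x - G y, x - y⟫)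
    (u : Finset C) : ∃ x ∈ C, ∀ y ∈ u, ⟪G y, x - y⟫ ≤ 0 := by
  classical
  by_contra! hcon
  let L : E → (u → ℝ) := fun x i => ⟪G (i.1 : E), x - (i.1 : E)⟫
  have hLc : Continuous L := by fun_prop
  have hSconv : Convex ℝ (L '' C) := by
    rintro _ ⟨a, ha, rfl⟩ _ ⟨b, hb, rfl⟩ s t hs ht hst
    refine ⟨s • a + t • b, hconv ha hb hs ht hst, ?_⟩
    ext i
    simp only [L, Pi.add_apply, Pi.smul_apply, smul_eq_mul, inner_sub_right, inner_add_right,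
      inner_smul_right]
    linear_combination (⟪G (i.1 : E), (i.1 : E)⟫) * hst
  have hdisj : Disjoint (L '' C) (Set.Iic 0) := by
    rw [Set.disjoint_left]
    rintro _ ⟨x, hx, rfl⟩ hle
    obtain ⟨y, hy, hpos⟩ := hcon x hx
    exact absurd (hle ⟨y, hy⟩) (not_le.2 hpos)
  obtain ⟨φ, a, b, hφa, hab, hφb⟩ := geometric_hahn_banach_compact_closed hSconv
    (hcomp.image hLc) (convex_Iic (0 : u → ℝ)) isClosed_Iic hdisj
  have hb0 : b < 0 := by simpa using hφb 0 (Set.mem_Iic.2 le_rfl)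
  set w : u → ℝ := fun i => -φ (Pi.single i 1) with hw
  have hφ : ∀ v : u → ℝ, φ v = -∑ i, w i * v i := by
    intro v
    conv_lhs => rw [← Finset.univ_sum_single v]
    rw [map_sum, ← Finset.sum_neg_distrib]
    refine Finset.sum_congr rfl fun i _ => ?_
    have : (Pi.single i (v i) : u → ℝ) = v i • Pi.single i 1 := by
      rw [← Pi.single_smul, smul_eq_mul, mul_one]
    rw [this, map_smul, smul_eq_mul, hw]
    ring
  have hw0 : ∀ i, 0 ≤ w i := by
    intro i
    by_contra! hneg
    have h := hφb ((b / w i) • (-Pi.single i 1)) (by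
      have h1 : 0 ≤ b / w i := div_nonneg_of_nonpos hb0.le hneg.le
      have h2 : (0 : u → ℝ) ≤ Pi.single i 1 := Pi.single_nonneg.2 zero_le_one
      exact smul_nonpos_of_nonneg_of_nonpos h1 (neg_nonpos.2 h2))
    rw [map_smul, map_neg, smul_eq_mul, show -φ (Pi.single i 1) = w i from rfl,
      div_mul_cancel₀ _ hneg.ne] at h
    exact lt_irrefl _ h
  have hpos : ∀ x ∈ C, 0 < ∑ i, w i * ⟪G (i.1 : E), x - (i.1 : E)⟫ := by
    intro x hx
    have h := hφa (L x) ⟨x, hx, rfl⟩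
    rw [hφ] at h
    change 0 < ∑ i, w i * L x i
    linarith
  have hW : 0 < ∑ i, w i := by
    refine (Finset.sum_nonneg fun i _ => hw0 i).lt_of_ne fun h => ?_
    have hz := (Finset.sum_eq_zero_iff_of_nonneg fun i _ => hw0 i).1 h.symm
    obtain ⟨x, hx⟩ := hne
    refine (hpos x hx).ne' (Finset.sum_eq_zero fun i hi => ?_)
    rw [hz i hi, zero_mul]
  have hbar := hpos _ (hconv.centerMass_mem (t := Finset.univ) (z := fun i : u => (i.1 : E))
    (fun i _ => hw0 i) hW fun i _ => i.1.2)
  have hexp : (∑ i, w i) * ∑ i, w i * ⟪G (i.1 : E),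
      Finset.univ.centerMass w (fun i : u => (i.1 : E)) - (i.1 : E)⟫ =
      ∑ i, ∑ j, w i * w j * ⟪G (i.1 : E), (j.1 : E) - (i.1 : E)⟫ := by
    rw [Finset.mul_sum]
    refine Finset.sum_congr rfl fun i _ => ?_
    have h : (∑ j, w j) • (Finset.univ.centerMass w (fun j : u => (j.1 : E)) - (i.1 : E)) =
        ∑ j, w j • ((j.1 : E) - (i.1 : E)) := by
      rw [smul_sub, Finset.centerMass, smul_inv_smul₀ hW.ne', Finset.sum_smul,
        ← Finset.sum_sub_distrib]
      simp only [smul_sub]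
    have h' := congrArg (fun v => ⟪G (i.1 : E), v⟫) h
    simp only [inner_smul_right, inner_sum] at h'
    rw [mul_left_comm, h', Finset.mul_sum]
    exact Finset.sum_congr rfl fun j _ => by ring
  have hle : ∑ i, ∑ j, w i * w j * ⟪G (i.1 : E), (j.1 : E) - (i.1 : E)⟫ +
      ∑ i, ∑ j, w i * w j * ⟪G (i.1 : E), (j.1 : E) - (i.1 : E)⟫ ≤ 0 := by
    conv_lhs => enter [2]; rw [Finset.sum_comm]
    rw [← Finset.sum_add_distrib]
    refine Finset.sum_nonpos fun i _ => ?_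
    rw [← Finset.sum_add_distrib]
    refine Finset.sum_nonpos fun j _ => ?_
    have h := mul_nonneg (mul_nonneg (hw0 i) (hw0 j)) (hGm (i.1 : E) (j.1 : E))
    simp only [inner_sub_left, inner_sub_right] at h ⊢
    linarith
  have := mul_pos hW hbar
  rw [hexp] at this
  linarith

/-- A monotone map on a nonempty convex compact set has a solution of the Minty variational
inequality. -/
theorem exists_forall_inner_sub_nonpos {E : Type*} [NormedAddCommGroup E]
    [InnerProductSpace ℝ E] {C : Set E} (hne : C.Nonempty) (hconv : Convex ℝ C)
    (hcomp : IsCompact C) {G : E → E} (hGm : ∀ x y : E, 0 ≤ ⟪G x - G y, x - y⟫) :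
    ∃ x ∈ C, ∀ y ∈ C, ⟪G y, x - y⟫ ≤ 0 := by
  obtain ⟨x, hx, hxi⟩ := hcomp.inter_iInter_nonempty
    (fun y : C => {x : E | ⟪G y, x - y⟫ ≤ 0})
    (fun y => isClosed_le (by fun_prop) continuous_const) (fun u => by
      obtain ⟨x, hx, h⟩ := exists_forall_inner_sub_nonpos_of_finset hne hconv hcomp hGm u
      exact ⟨x, hx, Set.mem_iInter₂.2 h⟩)
  exact ⟨x, hx, fun y hy => Set.mem_iInter.1 hxi ⟨y, hy⟩⟩

/-- Each value defining `psiMB` is at most `psiMB` when `B` lies in a compact set. -/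
theorem inner_sub_le_psiMB {n : ℕ} {C B : Set (EuclideanSpace ℝ (Fin n))} (hcomp : IsCompact C)
    {G : EuclideanSpace ℝ (Fin n) → EuclideanSpace ℝ (Fin n)} (hGc : Continuous G)
    (hBsub : B ⊆ C) (x : EuclideanSpace ℝ (Fin n)) {y : EuclideanSpace ℝ (Fin n)} (hy : y ∈ B) :
    ⟪G y, x - y⟫ ≤ psiMB G B x := by
  have hc : Continuous fun y => ⟪G y, x - y⟫ := by fun_prop
  exact le_csSup ((hcomp.image hc).bddAbove.mono (Set.image_mono hBsub)) ⟨y, hy, rfl⟩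

/-- Exact penalization: there is `ρ_B > 0` such that for every `ρ ≥ ρ_B`
every minimizer over `C` of `f + ρ (ψ^M_B − ε)⁺` is feasible for and optimal for
`min {f(x) : x ∈ C, ψ^M_B(x) ≤ ε}`. -/
theorem exact_penalty_for_B {n : ℕ} (C : Set (EuclideanSpace ℝ (Fin n)))
    (hne : C.Nonempty) (hconv : Convex ℝ C) (hcomp : IsCompact C)
    (f : EuclideanSpace ℝ (Fin n) → ℝ) (hf : ConvexOn ℝ Set.univ f)
    (G : EuclideanSpace ℝ (Fin n) → EuclideanSpace ℝ (Fin n))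
    (hGc : Continuous G)
    (hGm : ∀ x y : EuclideanSpace ℝ (Fin n), 0 ≤ ⟪G x - G y, x - y⟫)
    (ε : ℝ) (hε : 0 < ε)
    (B : Set (EuclideanSpace ℝ (Fin n))) (hBne : B.Nonempty) (hBsub : B ⊆ C) :
    ∃ ρB > (0 : ℝ), ∀ ρ ≥ ρB, ∀ x ∈ C,
      (∀ z ∈ C, f x + ρ * max (psiMB G B x - ε) 0 ≤ f z + ρ * max (psiMB G B z - ε) 0) →
        psiMB G B x ≤ ε ∧ ∀ z ∈ C, psiMB G B z ≤ ε → f x ≤ f z := by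
  obtain ⟨x₀, hx₀, hmin⟩ := exists_forall_inner_sub_nonpos hne hconv hcomp hGm
  have hfc : Continuous f := continuousOn_univ.1 (hf.continuousOn isOpen_univ)
  obtain ⟨p, -, hp⟩ := hcomp.exists_isMinOn hne hfc.continuousOn
  have hpm : ∀ x ∈ C, f p ≤ f x := fun x hx => hp hx
  refine ⟨(f x₀ - f p) / ε + 1, ?_, fun ρ hρ x hx hxmin => ?_⟩
  · have := div_nonneg (sub_nonneg.2 (hpm x₀ hx₀)) hε.le
    linarith
  have hfeas : psiMB G B x ≤ ε := by
    by_contra! hlt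
    set ψ := psiMB G B x with hψ
    have hψ0 : 0 < ψ := hε.trans hlt
    set s := ε / ψ with hs
    have hs0 : 0 < s := div_pos hε hψ0
    have hs1 : s < 1 := (div_lt_one hψ0).2 hlt
    have hsψ : s * ψ = ε := div_mul_cancel₀ _ hψ0.ne'
    have hz : psiMB G B (s • x + (1 - s) • x₀) ≤ ε := by
      refine csSup_le (hBne.image _) ?_
      rintro _ ⟨y, hy, rfl⟩
      have h1 := mul_le_mul_of_nonneg_left (inner_sub_le_psiMB hcomp hGc hBsub x hy) hs0.le
      have h2 := mul_nonpos_of_nonneg_of_nonpos (sub_nonneg.2 hs1.le) (hmin y (hBsub hy))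
      simp only [inner_sub_right, inner_add_right, inner_smul_right] at h1 h2 ⊢
      linarith
    have hle := hxmin _ (hconv hx hx₀ hs0.le (sub_nonneg.2 hs1.le) (by ring))
    rw [max_eq_right (sub_nonpos.2 hz), max_eq_left (sub_nonneg.2 hlt.le)] at hle
    have hfz := hf.2 (Set.mem_univ x) (Set.mem_univ x₀) hs0.le (sub_nonneg.2 hs1.le) (by ring)
    simp only [smul_eq_mul] at hfz
    have hfx := mul_le_mul_of_nonneg_left (hpm x hx) (sub_nonneg.2 hs1.le)
    have hkey : (1 - s) * (ρ * ψ) ≤ (1 - s) * (f x₀ - f p) := by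
      have : ρ * (ψ - ε) = (1 - s) * (ρ * ψ) := by rw [← hsψ]; ring
      linarith
    have hkey' := le_of_mul_le_mul_left hkey (sub_pos.2 hs1)
    have hρε : f x₀ - f p + ε ≤ ρ * ε := by
      have h := mul_le_mul_of_nonneg_right hρ hε.le
      rwa [add_mul, div_mul_cancel₀ _ hε.ne', one_mul] at h
    have hρ0 : 0 < ρ := by
      have := div_nonneg (sub_nonneg.2 (hpm x₀ hx₀)) hε.le
      linarith
    have := mul_lt_mul_of_pos_left hlt hρ0
    linarith
  refine ⟨hfeas, fun z hz hzε => ?_⟩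
  have h := hxmin z hz
  rwa [max_eq_right (sub_nonpos.2 hfeas), max_eq_right (sub_nonpos.2 hzε), mul_zero, add_zero,
    add_zero] at h
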